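/- arXiv:2302.14273 — 2 statements merged into one kernel-verified Lean document; each statement's English description precedes it below -/
import Mathlib

section
/- Let q, o ∈ ℝ², r_q, r_o ≥ 0, d₁ = ‖q − o‖, r_qo = r_q + r_o, and suppose d₁ > r_qo. Let d₂ = √(d₁² − r_qo²) and let M be the 2×2 matrix with rows (r_qo, −d₂) and (d₂, r_qo). Then for every x ∈ ℝ² with ‖x − q‖ ≤ r_q, one has ⟨q − o, M(x − o)⟩ ≥ r_o·d₁², i.e., the closed ball B(q, r_q) is contained in the target-visible region V_O = {x ∈ ℝ² : ⟨q − o, M(x − o)⟩ ≥ r_o·d₁²}. The same holds when M is replaced by its transpose. -/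
/-- If the matrix with rows `(c, -s)` and `(s, c)` scales lengths by `D = ‖(a, b)‖`, then its
pairing with `(a, b)` is at least `(c - r) * D ^ 2` on the disc of radius `r` around `(a, b)`. -/
theorem pairing_ge_of_sq_add_sq_le {a b c s y z D r : ℝ} (hr : 0 ≤ r)
    (hab : a ^ 2 + b ^ 2 = D ^ 2) (hcs : c ^ 2 + s ^ 2 = D ^ 2)
    (hyz : (y - a) ^ 2 + (z - b) ^ 2 ≤ r ^ 2) :
    (c - r) * D ^ 2 ≤ a * (c * y - s * z) + b * (s * y + c * z) := by
  set p := a * c + b * s with hp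
  set t := b * c - a * s with ht
  have hpt : p ^ 2 + t ^ 2 = (D ^ 2) ^ 2 := by
    calc p ^ 2 + t ^ 2 = (a ^ 2 + b ^ 2) * (c ^ 2 + s ^ 2) := by rw [hp, ht]; ring
      _ = (D ^ 2) ^ 2 := by rw [hab, hcs]; ring
  have hsq : (p * (y - a) + t * (z - b)) ^ 2 ≤ (D ^ 2 * r) ^ 2 := by
    calc (p * (y - a) + t * (z - b)) ^ 2
        ≤ (p ^ 2 + t ^ 2) * ((y - a) ^ 2 + (z - b) ^ 2) := by
          linarith [sq_nonneg (p * (z - b) - t * (y - a))]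
      _ ≤ (D ^ 2) ^ 2 * r ^ 2 := by rw [hpt]; gcongr
      _ = (D ^ 2 * r) ^ 2 := by ring
  have hlow := (abs_le_of_sq_le_sq' hsq (by positivity)).1
  have hsplit : a * (c * y - s * z) + b * (s * y + c * z) =
      c * D ^ 2 + (p * (y - a) + t * (z - b)) := by
    rw [hp, ht, ← hab]; ring
  linarith

/-- **TVR-O contains the target's reachable ball (disjoint case).**
With `d₁ = ‖q − o‖ > r_qo = r_q + r_o`, `d₂ = √(d₁² − r_qo²)` and `M` the 2×2 matrix
with rows `(r_qo, −d₂)` and `(d₂, r_qo)`, every `x` with `‖x − q‖ ≤ r_q` satisfies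
`⟨q − o, M(x − o)⟩ ≥ r_o·d₁²`, and likewise with `M` replaced by its transpose. -/
theorem target_ball_subset_TVRO
    (q o : EuclideanSpace ℝ (Fin 2)) (rq ro : ℝ)
    (hrq : 0 ≤ rq) (hro : 0 ≤ ro)
    (d₁ : ℝ) (hd₁ : d₁ = ‖q - o‖)
    (rqo : ℝ) (hrqo : rqo = rq + ro)
    (hsep : rqo < d₁)
    (d₂ : ℝ) (hd₂ : d₂ = Real.sqrt (d₁ ^ 2 - rqo ^ 2)) :
    ∀ x : EuclideanSpace ℝ (Fin 2), ‖x - q‖ ≤ rq →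
      ((q - o) 0 * (rqo * (x - o) 0 - d₂ * (x - o) 1) +
       (q - o) 1 * (d₂ * (x - o) 0 + rqo * (x - o) 1) ≥ ro * d₁ ^ 2) ∧
      ((q - o) 0 * (rqo * (x - o) 0 + d₂ * (x - o) 1) +
       (q - o) 1 * (-d₂ * (x - o) 0 + rqo * (x - o) 1) ≥ ro * d₁ ^ 2) := by
  intro x hx
  have hnorm (v : EuclideanSpace ℝ (Fin 2)) : v 0 ^ 2 + v 1 ^ 2 = ‖v‖ ^ 2 := by
    rw [EuclideanSpace.real_norm_sq_eq, Fin.sum_univ_two]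
  have hab : (q - o) 0 ^ 2 + (q - o) 1 ^ 2 = d₁ ^ 2 := by rw [hnorm, hd₁]
  have hcs : rqo ^ 2 + d₂ ^ 2 = d₁ ^ 2 := by
    rw [hd₂, Real.sq_sqrt (by nlinarith)]; ring
  have hyz : ((x - o) 0 - (q - o) 0) ^ 2 + ((x - o) 1 - (q - o) 1) ^ 2 ≤ rq ^ 2 := by
    rw [← PiLp.sub_apply, ← PiLp.sub_apply, sub_sub_sub_cancel_right, hnorm]
    gcongr
  have hro' : rqo - rq = ro := by linarith
  have h₁ := pairing_ge_of_sq_add_sq_le hrq hab hcs hyz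
  have h₂ := pairing_ge_of_sq_add_sq_le (c := rqo) (s := -d₂) hrq hab (by rwa [neg_sq]) hyz
  rw [hro'] at h₁ h₂
  exact ⟨h₁, by linarith⟩
end

section
/- Let q, o ∈ ℝ², r_q, r_o ≥ 0, d₁ = ‖q − o‖, r_qo = r_q + r_o, suppose d₁ > r_qo, let d₂ = √(d₁² − r_qo²), let M be the 2×2 matrix with rows (r_qo, −d₂) and (d₂, r_qo), and let V_O = {x ∈ ℝ² : ⟨q − o, M(x − o)⟩ ≥ r_o·d₁²}. If c ∈ V_O, then for every q' with ‖q' − q‖ ≤ r_q and every ε ∈ [0,1], the point (1−ε)·c + ε·q' satisfies ‖(1−ε)·c + ε·q' − o‖ ≥ r_o; i.e., every line segment from c to the target's reachable ball B(q, r_q) avoids the open obstacle ball of radius r_o around o. -/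
/-- A segment whose endpoints lie in a half-plane at signed distance at least `r` from the origin
stays outside the open ball of radius `r` around the origin. -/
theorem le_norm_of_segment_mem_halfSpace {E : Type*} [NormedAddCommGroup E]
    [InnerProductSpace ℝ E] {n a b : E} {r ε : ℝ} (hn : 0 < ‖n‖)
    (ha : r * ‖n‖ ≤ inner ℝ a n) (hb : r * ‖n‖ ≤ inner ℝ b n) (hε : ε ∈ Set.Icc (0 : ℝ) 1) :
    r ≤ ‖(1 - ε) • a + ε • b‖ := by
  have hcs := real_inner_le_norm ((1 - ε) • a + ε • b) n
  rw [inner_add_left, real_inner_smul_left, real_inner_smul_left] at hcs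
  have h₁ := mul_le_mul_of_nonneg_left ha (sub_nonneg.2 hε.2)
  have h₂ := mul_le_mul_of_nonneg_left hb hε.1
  exact le_of_mul_le_mul_right (by linarith) hn


/-- **Lemma 1 for the explicit half-plane TVR-O.**
With `d₁ = ‖q − o‖ > r_qo = r_q + r_o`, `d₂ = √(d₁² − r_qo²)` and `M` the 2×2 matrix
with rows `(r_qo, −d₂)` and `(d₂, r_qo)`: if the drone position `c` lies in
`V_O = {x : ⟨q − o, M(x − o)⟩ ≥ r_o·d₁²}`, then every point of every line segment
from `c` to a point `q'` of the target's reachable ball `B(q, r_q)` stays at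
distance at least `r_o` from the obstacle center `o`. -/
theorem los_from_TVRO_avoids_obstacle
    (q o c : EuclideanSpace ℝ (Fin 2)) (rq ro : ℝ)
    (hrq : 0 ≤ rq) (hro : 0 ≤ ro)
    (d₁ : ℝ) (hd₁ : d₁ = ‖q - o‖)
    (rqo : ℝ) (hrqo : rqo = rq + ro)
    (hsep : rqo < d₁)
    (d₂ : ℝ) (hd₂ : d₂ = Real.sqrt (d₁ ^ 2 - rqo ^ 2))
    (hc : (q - o) 0 * (rqo * (c - o) 0 - d₂ * (c - o) 1) +
          (q - o) 1 * (d₂ * (c - o) 0 + rqo * (c - o) 1) ≥ ro * d₁ ^ 2) :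
    ∀ q' : EuclideanSpace ℝ (Fin 2), ‖q' - q‖ ≤ rq →
      ∀ ε ∈ Set.Icc (0:ℝ) 1, ‖(1 - ε) • c + ε • q' - o‖ ≥ ro := by
  intro q' hq' ε hε
  have hd₁_pos : 0 < d₁ := by linarith
  have hd₁_sq : d₁ ^ 2 = (q - o) 0 ^ 2 + (q - o) 1 ^ 2 := by
    rw [hd₁, EuclideanSpace.real_norm_sq_eq, Fin.sum_univ_two]
  have hd₂_sq : d₂ ^ 2 = d₁ ^ 2 - rqo ^ 2 := by
    rw [hd₂, Real.sq_sqrt]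
    nlinarith
  let n : EuclideanSpace ℝ (Fin 2) :=
    !₂[rqo * (q - o) 0 + d₂ * (q - o) 1, rqo * (q - o) 1 - d₂ * (q - o) 0]
  have inner_n (v : EuclideanSpace ℝ (Fin 2)) : inner ℝ v n =
      v 0 * (rqo * (q - o) 0 + d₂ * (q - o) 1) + v 1 * (rqo * (q - o) 1 - d₂ * (q - o) 0) := by
    simp [n, PiLp.inner_apply, Fin.sum_univ_two, mul_comm]
  have norm_n : ‖n‖ = d₁ ^ 2 := by
    rw [← sq_eq_sq₀ (norm_nonneg _) (sq_nonneg _), EuclideanSpace.real_norm_sq_eq,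
      Fin.sum_univ_two]
    change (rqo * (q - o) 0 + d₂ * (q - o) 1) ^ 2 + (rqo * (q - o) 1 - d₂ * (q - o) 0) ^ 2 = _
    linear_combination (-(rqo ^ 2 + d₂ ^ 2)) * hd₁_sq + d₁ ^ 2 * hd₂_sq
  have hc_n : ro * ‖n‖ ≤ inner ℝ (c - o) n := by
    rw [norm_n, inner_n]
    linarith
  have hq_n : inner ℝ (q - o) n = rqo * ‖n‖ := by
    rw [norm_n, inner_n]
    linear_combination (-rqo) * hd₁_sq
  have hq'_n : ro * ‖n‖ ≤ inner ℝ (q' - o) n := by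
    rw [← sub_add_sub_cancel q' q o, inner_add_left, hq_n, hrqo]
    have h₁ := neg_le_of_abs_le (abs_real_inner_le_norm (q' - q) n)
    have h₂ := mul_le_mul_of_nonneg_right hq' (norm_nonneg n)
    linarith
  have hsub : (1 - ε) • c + ε • q' - o = (1 - ε) • (c - o) + ε • (q' - o) := by module
  rw [hsub]
  exact le_norm_of_segment_mem_halfSpace (norm_n ▸ pow_pos hd₁_pos 2) hc_n hq'_n hε
end
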